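/- Let η > 0 and let Ẽ be a k-tuple of pseudocodewords of degree t ≥ 2kd·(1 + |Σ_in|^{3kd}/η²). Then there exists a set S ⊆ E with |S| ≤ d·|Σ_in|^{3kd}/η² such that the randomly conditioned operator Ẽ[· | Z_{[k]×S}] is η-good; explicitly, E_{ℓ∈L, r∈R}[ Σ_{γ ∈ Σ_in^{[k]×S}, Ẽ[Z_{[k]×S,γ}] > 0} Ẽ[Z_{[k]×S,γ}] · Coṽ_γ(Z_{[k]×N(ℓ)}, Z_{[k]×N(r)}) ] ≤ η, where Coṽ_γ denotes pseudocovariance computed with the conditioned operator Ẽ[· | Z_{[k]×S} = γ] := Ẽ[(·)·Z_{[k]×S,γ}] / Ẽ[Z_{[k]×S,γ}]. -/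

import Mathlib

open Finset MvPolynomial
open scoped Classical

noncomputable section

/-- The SoS variables `Z_{i,e,σ}`: one for each row `i ∈ [k]`, edge `e` (an edge of the
AEL graph, identified with a pair in `L × [d]`) and symbol `σ ∈ Σ_in`. -/
abbrev SoSVar (k n d : ℕ) (A : Type*) : Type _ := Fin k × (Fin n × Fin d) × A

variable {A : Type*} [Fintype A] {k n d : ℕ}

/-- The monomial `Z_{{i}×N(ℓ), a}` selecting local assignment `a` for row `i` at the
left vertex `ℓ`. -/
def ZL (i : Fin k) (ℓ : Fin n) (a : Fin d → A) : MvPolynomial (SoSVar k n d A) ℝ :=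
  ∏ j : Fin d, X (i, (ℓ, j), a j)

/-- The monomial `Z_{{i}×N(r), a}` selecting local assignment `a` for row `i` at the
right vertex `r` (via the right identification `eR` of edges). -/
def ZR (eR : Fin n × Fin d ≃ Fin n × Fin d) (i : Fin k) (r : Fin n) (a : Fin d → A) :
    MvPolynomial (SoSVar k n d A) ℝ :=
  ∏ j : Fin d, X (i, eR.symm (r, j), a j)

/-- A degree-`t` pseudoexpectation: a linear functional with `Ẽ[1]=1`, nonnegative on
squares of degree ≤ t/2, and respecting the Boolean and normalization constraints. -/
def IsPseudoExpectation (PE : MvPolynomial (SoSVar k n d A) ℝ →ₗ[ℝ] ℝ) (t : ℕ) : Prop :=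
  PE 1 = 1 ∧
  (∀ p : MvPolynomial (SoSVar k n d A) ℝ, 2 * p.totalDegree ≤ t → 0 ≤ PE (p ^ 2)) ∧
  (∀ (p : MvPolynomial (SoSVar k n d A) ℝ) (v : SoSVar k n d A),
      p.totalDegree + 2 ≤ t → PE (p * (X v ^ 2 - X v)) = 0) ∧
  (∀ (p : MvPolynomial (SoSVar k n d A) ℝ) (i : Fin k) (e : Fin n × Fin d),
      p.totalDegree + 1 ≤ t → PE (p * ((∑ σ : A, X (i, e, σ)) - 1)) = 0)

/-- A `k`-tuple of pseudocodewords of degree `t`: a degree-`t` pseudoexpectation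
additionally annihilating local assignments outside the inner code. -/
def IsPseudocodeword (Cin : Set (Fin d → A)) (PE : MvPolynomial (SoSVar k n d A) ℝ →ₗ[ℝ] ℝ)
    (t : ℕ) : Prop :=
  IsPseudoExpectation PE t ∧
  ∀ (p : MvPolynomial (SoSVar k n d A) ℝ) (i : Fin k) (ℓ : Fin n) (a : Fin d → A),
    a ∉ Cin → p.totalDegree + d ≤ t → PE (p * ZL i ℓ a) = 0

/-- The pseudo left distance `Ẽ[Δ_L(Z_i, Z_{i'})]`. -/
def pdeltaL (PE : MvPolynomial (SoSVar k n d A) ℝ →ₗ[ℝ] ℝ) (i i' : Fin k) : ℝ :=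
  (∑ ℓ : Fin n, PE (∑ a : Fin d → A, ∑ b : Fin d → A,
      if a ≠ b then ZL i ℓ a * ZL i' ℓ b else 0)) / n

/-- The polynomial `D_{S,r}(g,Z)`: the indicator that `r` is a common error location for
all rows `i ∈ S` with respect to `g`. -/
def Dpoly (eR : Fin n × Fin d ≃ Fin n × Fin d) (g : Fin n × Fin d → A)
    (S : Finset (Fin k)) (r : Fin n) : MvPolynomial (SoSVar k n d A) ℝ :=
  ∏ i ∈ S, ∑ a : Fin d → A,
    if a ≠ (fun j => g (eR.symm (r, j))) then ZR eR i r a else 0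

/-- The pseudo right distance `Ẽ[Δ_R(g, Z_S)]` (common errors of the rows in `S`). -/
def pdeltaR (eR : Fin n × Fin d ≃ Fin n × Fin d)
    (PE : MvPolynomial (SoSVar k n d A) ℝ →ₗ[ℝ] ℝ)
    (g : Fin n × Fin d → A) (S : Finset (Fin k)) : ℝ :=
  (∑ r : Fin n, PE (Dpoly eR g S r)) / n

/-- The monomial `Z_{T,γ}` for a set `T ⊆ [k] × E` and assignment `γ : T → Σ_in`. -/
def ZA (T : Finset (Fin k × (Fin n × Fin d))) (γ : {x // x ∈ T} → A) :
    MvPolynomial (SoSVar k n d A) ℝ :=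
  ∏ x : {x // x ∈ T}, X (x.1.1, x.1.2, γ x)

/-- Pseudocovariance of the coordinate sets `T1, T2` with respect to an operator `F`. -/
def CovF (F : MvPolynomial (SoSVar k n d A) ℝ → ℝ)
    (T1 T2 : Finset (Fin k × (Fin n × Fin d))) : ℝ :=
  ∑ a : {x // x ∈ T1} → A, ∑ b : {x // x ∈ T2} → A,
    |F (ZA T1 a * ZA T2 b) - F (ZA T1 a) * F (ZA T2 b)|

/-- The set `[k] × N(ℓ)` of coordinates. -/
def KNL (k : ℕ) {n : ℕ} (d : ℕ) (ℓ : Fin n) : Finset (Fin k × (Fin n × Fin d)) :=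
  Finset.univ ×ˢ (Finset.univ.image fun j : Fin d => ((ℓ, j) : Fin n × Fin d))

/-- The set `[k] × N(r)` of coordinates. -/
def KNR (k : ℕ) {n d : ℕ} (eR : Fin n × Fin d ≃ Fin n × Fin d) (r : Fin n) :
    Finset (Fin k × (Fin n × Fin d)) :=
  Finset.univ ×ˢ (Finset.univ.image fun j : Fin d => eR.symm (r, j))

/-- `Ẽ` is `η`-good: the average pseudocovariance between the local coordinate sets of a
uniformly random left vertex and a uniformly random right vertex is at most `η`. -/
def EtaGood (eR : Fin n × Fin d ≃ Fin n × Fin d)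
    (PE : MvPolynomial (SoSVar k n d A) ℝ →ₗ[ℝ] ℝ) (η : ℝ) : Prop :=
  (∑ ℓ : Fin n, ∑ r : Fin n, CovF (fun p => PE p) (KNL k d ℓ) (KNR k eR r)) / ((n : ℝ) * n) ≤ η

/-- The second-singular-value bound `λ` for the normalized biadjacency matrix. -/
def SingularBound (eR : Fin n × Fin d ≃ Fin n × Fin d) (lam : ℝ) : Prop :=
  ∀ x : Fin n → ℝ,
    Real.sqrt (∑ ℓ : Fin n,
        ((∑ j : Fin d, x ((eR (ℓ, j)).1)) / d - (∑ r : Fin n, x r) / n) ^ 2)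
      ≤ lam * Real.sqrt (∑ r : Fin n, x r ^ 2)

/-- `i` and `i'` lie in the same part of the partition `τ` of `[k]`. -/
def SamePart (τ : Finpartition (Finset.univ : Finset (Fin k))) (i i' : Fin k) : Prop :=
  ∃ P ∈ τ.parts, i ∈ P ∧ i' ∈ P

/-- The indicator polynomial `Λ_{ℓ,τ}(Z)` of the event that the local assignments at
`ℓ` induce exactly the partition `τ` of `[k]`. -/
def Lam (τ : Finpartition (Finset.univ : Finset (Fin k))) (ℓ : Fin n) :
    MvPolynomial (SoSVar k n d A) ℝ :=
  ∑ a : Fin k → Fin d → A,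
    if ∀ i i' : Fin k, (a i = a i' ↔ SamePart τ i i') then ∏ i : Fin k, ZL i ℓ (a i) else 0

/-- Fraction of erased coordinates of a partially erased word. -/
def eraseFrac {ι B : Type*} [Fintype ι] (g : ι → Option B) : ℝ :=
  ((Finset.univ.filter fun i => g i = none).card : ℝ) / (Fintype.card ι)

/-- Distance of a partially erased word to a word (non-erased disagreements only). -/
def deltaE {ι B : Type*} [Fintype ι] (g : ι → Option B) (h : ι → B) : ℝ :=
  ((Finset.univ.filter fun i => g i ≠ none ∧ g i ≠ some (h i)).card : ℝ) / (Fintype.card ι)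

/-- `(δ, k, ε)` average-radius list decodable with erasures. -/
def ARLDE {ι B : Type*} [Fintype ι] (C : Set (ι → B)) (δ : ℝ) (k : ℕ) (ε : ℝ) : Prop :=
  ∀ g : ι → Option B, ∀ H : Finset (ι → B), ↑H ⊆ C → H.card ≤ k →
    ((H.card : ℝ) - 1) * (δ - eraseFrac g - ε) ≤ ∑ h ∈ H, deltaE g h

set_option linter.unusedSectionVars false

/-- The squarefree monomial with variable set `U`. -/
def sqfreeMonomial (U : Finset (SoSVar k n d A)) : MvPolynomial (SoSVar k n d A) ℝ :=
  ∏ v ∈ U, X v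

/-- The set of variables set to one by the assignment `γ`. -/
def assignmentGraph (T : Finset (Fin k × (Fin n × Fin d))) (γ : {x // x ∈ T} → A) :
    Finset (SoSVar k n d A) :=
  Finset.univ.image fun x => (x.1.1, x.1.2, γ x)

theorem ZA_eq_sqfreeMonomial (T : Finset (Fin k × (Fin n × Fin d))) (γ : {x // x ∈ T} → A) :
    ZA T γ = sqfreeMonomial (assignmentGraph T γ) := by
  rw [ZA, sqfreeMonomial, assignmentGraph, Finset.prod_image]
  rintro ⟨⟨i, e⟩, hx⟩ - ⟨⟨j, f⟩, hy⟩ - h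
  simp only [Prod.mk.injEq] at h
  obtain ⟨rfl, rfl, -⟩ := h
  rfl

theorem card_assignmentGraph_le (T : Finset (Fin k × (Fin n × Fin d))) (γ : {x // x ∈ T} → A) :
    (assignmentGraph T γ).card ≤ T.card := by
  refine Finset.card_image_le.trans ?_
  simp

theorem totalDegree_sqfreeMonomial_le (U : Finset (SoSVar k n d A)) :
    (sqfreeMonomial U).totalDegree ≤ U.card := by
  refine (totalDegree_finsetProd _ _).trans ?_
  simp [totalDegree_X]

theorem totalDegree_ZA_le (T : Finset (Fin k × (Fin n × Fin d))) (γ : {x // x ∈ T} → A) :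
    (ZA T γ).totalDegree ≤ T.card := by
  rw [ZA_eq_sqfreeMonomial]
  exact (totalDegree_sqfreeMonomial_le _).trans (card_assignmentGraph_le T γ)

theorem assignmentGraph_union (U T : Finset (Fin k × (Fin n × Fin d)))
    (δ : {x // x ∈ U ∪ T} → A) :
    assignmentGraph (U ∪ T) δ =
      assignmentGraph U (fun x => δ ⟨x.1, Finset.mem_union_left T x.2⟩) ∪
        assignmentGraph T (fun x => δ ⟨x.1, Finset.mem_union_right U x.2⟩) := by
  ext v
  simp only [assignmentGraph, Finset.mem_image, Finset.mem_univ, true_and, Finset.mem_union,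
    Subtype.exists]
  constructor
  · rintro ⟨x, hx, rfl⟩
    rcases hx with h | h
    · exact Or.inl ⟨x, h, rfl⟩
    · exact Or.inr ⟨x, h, rfl⟩
  · rintro (⟨x, hx, rfl⟩ | ⟨x, hx, rfl⟩)
    · exact ⟨x, Or.inl hx, rfl⟩
    · exact ⟨x, Or.inr hx, rfl⟩

theorem mem_assignmentGraph (T : Finset (Fin k × (Fin n × Fin d))) (γ : {x // x ∈ T} → A)
    (x : {x // x ∈ T}) : (x.1.1, x.1.2, γ x) ∈ assignmentGraph T γ :=
  Finset.mem_image_of_mem _ (Finset.mem_univ x)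

namespace IsPseudoExpectation

variable {PE : MvPolynomial (SoSVar k n d A) ℝ →ₗ[ℝ] ℝ} {t : ℕ}

theorem map_mul_sqfreeMonomial_of_subset (h : IsPseudoExpectation PE t)
    (U W : Finset (SoSVar k n d A)) (hWU : W ⊆ U) :
    ∀ p : MvPolynomial (SoSVar k n d A) ℝ, p.totalDegree + U.card + W.card ≤ t →
      PE (p * (sqfreeMonomial U * sqfreeMonomial W)) = PE (p * sqfreeMonomial U) := by
  induction W using Finset.induction_on with
  | empty => intro p _; simp [sqfreeMonomial]
  | insert v W hv ih =>
    intro p hp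
    rw [Finset.card_insert_of_notMem hv] at hp
    have hvU : v ∈ U := hWU (Finset.mem_insert_self v W)
    have hU : sqfreeMonomial U = X v * sqfreeMonomial (U.erase v) :=
      (Finset.mul_prod_erase U X hvU).symm
    have hW : sqfreeMonomial (insert v W) = X v * sqfreeMonomial W := Finset.prod_insert hv
    rw [← ih (fun w hw => hWU (Finset.mem_insert_of_mem hw)) p (by omega), ← sub_eq_zero,
      ← map_sub]
    have hdeg : (p * (sqfreeMonomial (U.erase v) * sqfreeMonomial W)).totalDegree + 2 ≤ t := by
      have h1 := totalDegree_mul p (sqfreeMonomial (U.erase v) * sqfreeMonomial W)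
      have h2 := totalDegree_mul (sqfreeMonomial (U.erase v)) (sqfreeMonomial W)
      have h3 := totalDegree_sqfreeMonomial_le (U.erase v)
      have h4 := totalDegree_sqfreeMonomial_le W
      have h5 := Finset.card_erase_add_one hvU
      omega
    have := h.2.2.1 _ v hdeg
    rw [← this]
    congr 1
    rw [hU, hW]
    ring

theorem map_mul_sqfreeMonomial_mul (h : IsPseudoExpectation PE t)
    (U W : Finset (SoSVar k n d A)) (p : MvPolynomial (SoSVar k n d A) ℝ)
    (hp : p.totalDegree + U.card + W.card ≤ t) :
    PE (p * (sqfreeMonomial U * sqfreeMonomial W)) = PE (p * sqfreeMonomial (U ∪ W)) := by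
  have hUW : sqfreeMonomial U * sqfreeMonomial W =
      sqfreeMonomial (U ∪ W) * sqfreeMonomial (U ∩ W) := Finset.prod_union_inter.symm
  rw [hUW]
  refine h.map_mul_sqfreeMonomial_of_subset _ _
    (Finset.inter_subset_left.trans Finset.subset_union_left) p ?_
  have := Finset.card_union_add_card_inter U W
  omega

theorem map_sqfreeMonomial_mul (h : IsPseudoExpectation PE t)
    (U W : Finset (SoSVar k n d A)) (hp : U.card + W.card ≤ t) :
    PE (sqfreeMonomial U * sqfreeMonomial W) = PE (sqfreeMonomial (U ∪ W)) := by
  simpa using h.map_mul_sqfreeMonomial_mul U W 1 (by simpa using hp)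

theorem map_sqfreeMonomial_nonneg (h : IsPseudoExpectation PE t)
    (U : Finset (SoSVar k n d A)) (hU : 2 * U.card ≤ t) : 0 ≤ PE (sqfreeMonomial U) := by
  have h1 := h.map_sqfreeMonomial_mul U U (by omega)
  rw [Finset.union_self] at h1
  rw [← h1, ← sq]
  have := totalDegree_sqfreeMonomial_le U
  exact h.2.1 _ (by omega)

theorem map_mul_eq_zero (h : IsPseudoExpectation PE t)
    {p q : MvPolynomial (SoSVar k n d A) ℝ} (hp : 2 * p.totalDegree ≤ t)
    (hq : 2 * q.totalDegree ≤ t) (hp0 : PE (p ^ 2) = 0) : PE (p * q) = 0 := by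
  by_contra hne
  set s : ℝ := -(PE (q ^ 2) + 1) / (2 * PE (p * q)) with hs
  have hdeg : 2 * (s • p + q).totalDegree ≤ t := by
    have h1 := totalDegree_add (s • p) q
    have h2 := totalDegree_smul_le s p
    have h3 := max_le_iff.1 (le_refl (max (s • p).totalDegree q.totalDegree))
    rcases max_choice (s • p).totalDegree q.totalDegree with h4 | h4 <;> omega
  have hsq := h.2.1 _ hdeg
  have hexp : (s • p + q) ^ 2 = s ^ 2 • p ^ 2 + (2 * s) • (p * q) + q ^ 2 := by
    simp only [smul_eq_C_mul, map_mul, map_pow, map_ofNat]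
    ring
  rw [hexp, map_add, map_add, map_smul, map_smul, hp0, smul_eq_mul, smul_eq_mul] at hsq
  have : 2 * s * PE (p * q) = -(PE (q ^ 2) + 1) := by
    rw [hs]; field_simp
  linarith

theorem sum_map_insert (h : IsPseudoExpectation PE t)
    (U : Finset (SoSVar k n d A)) (hU : U.card + 1 ≤ t) (i : Fin k) (e : Fin n × Fin d) :
    ∑ σ : A, PE (sqfreeMonomial (insert (i, e, σ) U)) = PE (sqfreeMonomial U) := by
  have h1 := h.2.2.2 (sqfreeMonomial U) i e
    (by have := totalDegree_sqfreeMonomial_le U; omega)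
  rw [mul_sub, mul_one, map_sub, sub_eq_zero, Finset.mul_sum, map_sum] at h1
  rw [← h1]
  refine Finset.sum_congr rfl fun σ _ => ?_
  have h2 := h.map_sqfreeMonomial_mul U {(i, e, σ)} (by simpa using hU)
  rw [Finset.union_comm, ← Finset.insert_eq] at h2
  rw [← h2]
  simp [sqfreeMonomial]

theorem map_sqfreeMonomial_eq_zero (h : IsPseudoExpectation PE t) (h4 : 0 < k → 4 ≤ t)
    (U : Finset (SoSVar k n d A)) (hU : U.card ≤ 2 * (t / 2)) {i : Fin k} {e : Fin n × Fin d}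
    {σ τ : A} (hne : σ ≠ τ) (hσ : (i, e, σ) ∈ U) (hτ : (i, e, τ) ∈ U) :
    PE (sqfreeMonomial U) = 0 := by
  have ht := h4 i.pos
  have hne' : ((i, e, σ) : SoSVar k n d A) ≠ (i, e, τ) := by simpa using hne
  have hsub : ({(i, e, σ), (i, e, τ)} : Finset (SoSVar k n d A)) ⊆ U := by
    intro v hv
    simp only [Finset.mem_insert, Finset.mem_singleton] at hv
    rcases hv with rfl | rfl <;> assumption
  have hc2 := Finset.card_le_card hsub
  have hpair : ({(i, e, σ), (i, e, τ)} : Finset (SoSVar k n d A)).card = 2 :=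
    Finset.card_pair hne'
  obtain ⟨V, hVs, hVU, hVc⟩ := Finset.exists_subsuperset_card_eq
    (n := min U.card (t / 2)) hsub (by omega) (by omega)
  have hVσ : (i, e, σ) ∈ V := hVs (by simp)
  have hVτ : (i, e, τ) ∈ V := hVs (by simp)
  have hV : PE (sqfreeMonomial V) = 0 := by
    have hV' := Finset.card_erase_add_one hVτ
    have hsum := h.sum_map_insert (V.erase (i, e, τ)) (by omega) i e
    have hσV' : (i, e, σ) ∈ V.erase (i, e, τ) := Finset.mem_erase.2 ⟨hne', hVσ⟩
    rw [← Finset.add_sum_erase _ _ (Finset.mem_univ σ), Finset.insert_eq_of_mem hσV',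
      add_eq_left] at hsum
    have hnn : ∀ ρ ∈ Finset.univ.erase σ,
        0 ≤ PE (sqfreeMonomial (insert (i, e, ρ) (V.erase (i, e, τ)))) := by
      intro ρ _
      refine h.map_sqfreeMonomial_nonneg _ ?_
      have := Finset.card_insert_le (i, e, ρ) (V.erase (i, e, τ))
      omega
    have := (Finset.sum_eq_zero_iff_of_nonneg hnn).1 hsum τ
      (Finset.mem_erase.2 ⟨hne.symm, Finset.mem_univ τ⟩)
    rwa [Finset.insert_erase hVτ] at this
  have hUV : (U \ V).card = U.card - V.card := Finset.card_sdiff_of_subset hVU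
  have hprod : sqfreeMonomial U = sqfreeMonomial V * sqfreeMonomial (U \ V) := by
    rw [mul_comm]
    exact (Finset.prod_sdiff hVU).symm
  have hdV := totalDegree_sqfreeMonomial_le V
  have hdUV := totalDegree_sqfreeMonomial_le (U \ V)
  rw [hprod]
  refine h.map_mul_eq_zero (by omega) (by omega) ?_
  rw [sq, h.map_sqfreeMonomial_mul V V (by omega), Finset.union_self, hV]

theorem sum_map_mul_ZA (h : IsPseudoExpectation PE t) (T : Finset (Fin k × (Fin n × Fin d)))
    (p : MvPolynomial (SoSVar k n d A) ℝ) (hp : p.totalDegree + T.card ≤ t) :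
    ∑ b : {x // x ∈ T} → A, PE (p * ZA T b) = PE p := by
  have hkey : ∀ T' : Finset (Fin k × (Fin n × Fin d)), p.totalDegree + T'.card ≤ t →
      PE (p * ∏ x ∈ T', ∑ σ : A, X (x.1, x.2, σ)) = PE p := by
    intro T'
    induction T' using Finset.induction_on with
    | empty => simp
    | insert x T' hx ih =>
      intro hT'
      rw [Finset.card_insert_of_notMem hx] at hT'
      rw [← ih (by omega), Finset.prod_insert hx, ← sub_eq_zero, ← map_sub]
      have hdeg : (p * ∏ x ∈ T', ∑ σ : A, (X (x.1, x.2, σ) :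
          MvPolynomial (SoSVar k n d A) ℝ)).totalDegree + 1 ≤ t := by
        have h1 := totalDegree_mul p (∏ x ∈ T', ∑ σ : A, (X (x.1, x.2, σ) :
          MvPolynomial (SoSVar k n d A) ℝ))
        have h2 : (∏ x ∈ T', ∑ σ : A, (X (x.1, x.2, σ) :
            MvPolynomial (SoSVar k n d A) ℝ)).totalDegree ≤ T'.card := by
          refine (totalDegree_finsetProd _ _).trans ?_
          rw [Finset.card_eq_sum_ones]
          refine Finset.sum_le_sum fun y _ => totalDegree_finsetSum_le fun σ _ => ?_
          rw [totalDegree_X]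
        omega
      rw [← h.2.2.2 _ x.1 x.2 hdeg]
      congr 1
      ring
  rw [← hkey T hp, ← map_sum, ← Finset.mul_sum, ← Finset.prod_coe_sort, Finset.prod_univ_sum,
    Fintype.piFinset_univ]
  rfl

theorem map_ZA_nonneg (h : IsPseudoExpectation PE t) (T : Finset (Fin k × (Fin n × Fin d)))
    (hT : 2 * T.card ≤ t) (γ : {x // x ∈ T} → A) : 0 ≤ PE (ZA T γ) := by
  rw [ZA_eq_sqfreeMonomial]
  have := card_assignmentGraph_le T γ
  exact h.map_sqfreeMonomial_nonneg _ (by omega)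

theorem map_ZA_sq (h : IsPseudoExpectation PE t) (T : Finset (Fin k × (Fin n × Fin d)))
    (hT : 2 * T.card ≤ t) (γ : {x // x ∈ T} → A) : PE (ZA T γ * ZA T γ) = PE (ZA T γ) := by
  have := card_assignmentGraph_le T γ
  rw [ZA_eq_sqfreeMonomial, h.map_sqfreeMonomial_mul _ _ (by omega), Finset.union_self]

theorem map_ZA_mul_eq_zero (h : IsPseudoExpectation PE t) (h4 : 0 < k → 4 ≤ t)
    (U T : Finset (Fin k × (Fin n × Fin d))) {Q : Finset (Fin k × (Fin n × Fin d))}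
    (hc : Q.card + U.card + T.card ≤ 2 * (t / 2)) (a : {x // x ∈ Q} → A)
    (γ : {x // x ∈ U} → A) (b : {x // x ∈ T} → A)
    {x : Fin k × (Fin n × Fin d)} (hxU : x ∈ U) (hxT : x ∈ T) (hne : γ ⟨x, hxU⟩ ≠ b ⟨x, hxT⟩) :
    PE (ZA Q a * (ZA U γ * ZA T b)) = 0 := by
  have ha := card_assignmentGraph_le Q a
  have hg := card_assignmentGraph_le U γ
  have hb := card_assignmentGraph_le T b
  have hda := totalDegree_ZA_le Q a
  have hu := Finset.card_union_le (assignmentGraph U γ) (assignmentGraph T b)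
  have hu' := Finset.card_union_le (assignmentGraph Q a)
    (assignmentGraph U γ ∪ assignmentGraph T b)
  rw [ZA_eq_sqfreeMonomial U, ZA_eq_sqfreeMonomial T,
    h.map_mul_sqfreeMonomial_mul _ _ _ (by omega), ZA_eq_sqfreeMonomial Q,
    h.map_sqfreeMonomial_mul _ _ (by omega)]
  refine h.map_sqfreeMonomial_eq_zero h4 _ (by omega) hne
    (Finset.mem_union_right _ (Finset.mem_union_left _ (mem_assignmentGraph U γ ⟨x, hxU⟩)))
    (Finset.mem_union_right _ (Finset.mem_union_right _ (mem_assignmentGraph T b ⟨x, hxT⟩)))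

theorem map_mul_ZA_union (h : IsPseudoExpectation PE t)
    (U T : Finset (Fin k × (Fin n × Fin d))) (p : MvPolynomial (SoSVar k n d A) ℝ)
    (hc : p.totalDegree + U.card + T.card ≤ t) (δ : {x // x ∈ U ∪ T} → A) :
    PE (p * ZA (U ∪ T) δ) =
      PE (p * (ZA U (fun x => δ ⟨x.1, Finset.mem_union_left T x.2⟩) *
        ZA T (fun x => δ ⟨x.1, Finset.mem_union_right U x.2⟩))) := by
  have hg := card_assignmentGraph_le U (fun x => δ ⟨x.1, Finset.mem_union_left T x.2⟩)
  have hb := card_assignmentGraph_le T (fun x => δ ⟨x.1, Finset.mem_union_right U x.2⟩)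
  rw [ZA_eq_sqfreeMonomial, ZA_eq_sqfreeMonomial, ZA_eq_sqfreeMonomial,
    h.map_mul_sqfreeMonomial_mul _ _ _ (by omega), assignmentGraph_union]

/-- Bessel's inequality for the orthogonal family `ZA U δ`. -/
theorem sum_map_ZA_mul_sq_div_le (h : IsPseudoExpectation PE t) (h4 : 0 < k → 4 ≤ t)
    (Q U : Finset (Fin k × (Fin n × Fin d))) (hQ : 2 * Q.card ≤ t) (hU : 2 * U.card ≤ t)
    (a : {x // x ∈ Q} → A) :
    ∑ δ : {x // x ∈ U} → A, PE (ZA Q a * ZA U δ) ^ 2 / PE (ZA U δ) ≤ PE (ZA Q a) := by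
  set c : ({x // x ∈ U} → A) → ℝ := fun δ => PE (ZA Q a * ZA U δ) / PE (ZA U δ) with hc
  have horth : ∀ δ δ' : {x // x ∈ U} → A, δ ≠ δ' → PE (ZA U δ * ZA U δ') = 0 := by
    intro δ δ' hne
    obtain ⟨x, hx⟩ := Function.ne_iff.1 hne
    have := h.map_ZA_mul_eq_zero h4 U U (Q := ∅) (by simp; omega) (fun y => δ ⟨y.1, by
      exact absurd y.2 (Finset.notMem_empty _)⟩) δ δ' x.2 x.2 hx
    simpa [ZA] using this
  have hdeg : 2 * (ZA Q a - ∑ δ, C (c δ) * ZA U δ).totalDegree ≤ t := by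
    have h1 := totalDegree_sub (ZA Q a) (∑ δ, C (c δ) * ZA U δ)
    have h2 := totalDegree_ZA_le Q a
    have h3 : (∑ δ, C (c δ) * ZA U δ).totalDegree ≤ U.card := by
      refine totalDegree_finsetSum_le fun δ _ => (totalDegree_mul _ _).trans ?_
      rw [totalDegree_C, zero_add]
      exact totalDegree_ZA_le U δ
    rcases max_choice (ZA Q a).totalDegree (∑ δ, C (c δ) * ZA U δ).totalDegree with h5 | h5 <;>
      omega
  have hsq := h.2.1 _ hdeg
  have hexp : (ZA Q a - ∑ δ, C (c δ) * ZA U δ) ^ 2 =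
      ZA Q a * ZA Q a - (2 : ℝ) • ∑ δ, c δ • (ZA Q a * ZA U δ) +
        ∑ δ, ∑ δ', (c δ * c δ') • (ZA U δ * ZA U δ') := by
    have h1 : ∑ δ, ∑ δ', (c δ * c δ') • (ZA U δ * ZA U δ') =
        (∑ δ, C (c δ) * ZA U δ) * ∑ δ, C (c δ) * ZA U δ := by
      rw [Finset.sum_mul_sum]
      refine Finset.sum_congr rfl fun δ _ => Finset.sum_congr rfl fun δ' _ => ?_
      rw [smul_eq_C_mul, C_mul]
      ring
    have h2 : ∑ δ, c δ • (ZA Q a * ZA U δ) = ZA Q a * ∑ δ, C (c δ) * ZA U δ := by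
      rw [Finset.mul_sum]
      refine Finset.sum_congr rfl fun δ _ => ?_
      rw [smul_eq_C_mul]
      ring
    rw [h1, h2, smul_eq_C_mul, map_ofNat]
    ring
  rw [hexp, map_add, map_sub, h.map_ZA_sq Q hQ a, map_smul, map_sum, map_sum] at hsq
  have hlin : ∑ δ, PE (c δ • (ZA Q a * ZA U δ)) =
      ∑ δ, PE (ZA Q a * ZA U δ) ^ 2 / PE (ZA U δ) := by
    refine Finset.sum_congr rfl fun δ _ => ?_
    rw [map_smul, smul_eq_mul, hc]
    ring
  have hquad : ∑ δ, PE (∑ δ', (c δ * c δ') • (ZA U δ * ZA U δ')) =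
      ∑ δ, PE (ZA Q a * ZA U δ) ^ 2 / PE (ZA U δ) := by
    refine Finset.sum_congr rfl fun δ _ => ?_
    rw [map_sum, Finset.sum_eq_single δ, map_smul, h.map_ZA_sq U hU δ, smul_eq_mul]
    · simp only [hc]
      rcases eq_or_ne (PE (ZA U δ)) 0 with h0 | h0
      · simp [h0]
      · field_simp
    · intro δ' _ hne
      rw [map_smul, horth δ δ' hne.symm, smul_zero]
    · simp
  rw [hlin, hquad, smul_eq_mul] at hsq
  linarith

/-- Sums over assignments to a union, for summands vanishing on inconsistent pairs. -/
theorem sum_union_assignments (U T : Finset (Fin k × (Fin n × Fin d)))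
    (F : ({x // x ∈ U} → A) → ({x // x ∈ T} → A) → ℝ)
    (G : ({x // x ∈ U ∪ T} → A) → ℝ)
    (hG : ∀ δ, G δ = F (fun x => δ ⟨x.1, Finset.mem_union_left T x.2⟩)
      (fun x => δ ⟨x.1, Finset.mem_union_right U x.2⟩))
    (hF : ∀ γ b x (hU : x ∈ U) (hT : x ∈ T), γ ⟨x, hU⟩ ≠ b ⟨x, hT⟩ → F γ b = 0) :
    ∑ δ, G δ = ∑ γ, ∑ b, F γ b := by
  rw [← Fintype.sum_prod_type']
  refine Fintype.sum_of_injective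
    (fun δ : {x // x ∈ U ∪ T} → A =>
      ((fun x => δ ⟨x.1, Finset.mem_union_left T x.2⟩ : {x // x ∈ U} → A),
        (fun x => δ ⟨x.1, Finset.mem_union_right U x.2⟩ : {x // x ∈ T} → A))) ?_ _ _ ?_ hG
  · intro δ δ' hδ
    obtain ⟨h1, h2⟩ := Prod.mk.injEq .. ▸ hδ
    funext ⟨x, hx⟩
    rcases Finset.mem_union.1 hx with hx' | hx'
    · exact congrFun h1 ⟨x, hx'⟩
    · exact congrFun h2 ⟨x, hx'⟩
  · rintro ⟨γ, b⟩ hγb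
    by_contra hne
    refine hγb ⟨fun x => if hx : x.1 ∈ U then γ ⟨x.1, hx⟩ else
      b ⟨x.1, (Finset.mem_union.1 x.2).resolve_left hx⟩, ?_⟩
    refine Prod.ext (funext fun x => ?_) (funext fun x => ?_)
    · simp [x.2]
    · by_cases hx : x.1 ∈ U
      · simp only [hx, dite_true]
        by_contra hcon
        exact hne (hF γ b x.1 hx x.2 hcon)
      · simp [hx]

end IsPseudoExpectation

/-- A finite conditional-variance inequality: the squared `ℓ¹` covariance is controlled by the
variance drop obtained by conditioning on the second coordinate. -/
theorem mul_sq_sum_abs_cov_le {α β : Type*} [Fintype α] [Fintype β] (x : α → β → ℝ) (y : β → ℝ)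
    (u : α → ℝ) {g : ℝ} (hg : 0 < g) (hy : ∀ b, 0 ≤ y b) (hyg : ∑ b, y b = g)
    (hu : ∀ a, ∑ b, x a b = u a) (h0 : ∀ a b, y b = 0 → x a b = 0) :
    g * (∑ a, ∑ b, |x a b / g - u a / g * (y b / g)|) ^ 2 ≤
      Fintype.card α * ∑ a, (∑ b, x a b ^ 2 / y b - u a ^ 2 / g) := by
  have hcs := Finset.sum_sq_le_sum_mul_sum_of_sq_le_mul (Finset.univ : Finset (α × β))
    (r := fun z => |x z.1 z.2 / g - u z.1 / g * (y z.2 / g)|) (f := fun z => y z.2)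
    (g := fun z => y z.2 * (x z.1 z.2 / y z.2 - u z.1 / g) ^ 2 / g ^ 2)
    (fun z _ => hy z.2)
    (fun z _ => div_nonneg (mul_nonneg (hy z.2) (sq_nonneg _)) (sq_nonneg _))
    (fun z _ => le_of_eq <| by
      rw [sq_abs]
      rcases eq_or_ne (y z.2) 0 with h | h
      · simp [h, h0 z.1 z.2 h]
      · field_simp)
  rw [Fintype.sum_prod_type, Fintype.sum_prod_type, Fintype.sum_prod_type] at hcs
  simp only [hyg, Finset.sum_const, Finset.card_univ, nsmul_eq_mul] at hcs
  have hrow : ∀ a, ∑ b, y b * (x a b / y b - u a / g) ^ 2 / g ^ 2 =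
      (∑ b, x a b ^ 2 / y b - u a ^ 2 / g) / g ^ 2 := by
    intro a
    rw [← Finset.sum_div]
    congr 1
    have hterm : ∀ b, y b * (x a b / y b - u a / g) ^ 2 =
        x a b ^ 2 / y b - 2 * (u a / g) * x a b + (u a / g) ^ 2 * y b := by
      intro b
      rcases eq_or_ne (y b) 0 with h | h
      · simp [h, h0 a b h]
      · field_simp
        ring
    simp only [hterm, Finset.sum_add_distrib, Finset.sum_sub_distrib, ← Finset.mul_sum, hyg, hu]
    field_simp
    ring
  simp only [hrow, ← Finset.sum_div] at hcs
  refine (mul_le_mul_of_nonneg_left hcs hg.le).trans_eq ?_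
  field_simp

/-- The energy of the partition of `Q` by `U`: the sum over local assignments `a` of `Q` of the
squared norm of the projection of `ZA Q a` to the span of the `ZA U δ`. -/
def conditionalEnergy (PE : MvPolynomial (SoSVar k n d A) ℝ →ₗ[ℝ] ℝ)
    (Q U : Finset (Fin k × (Fin n × Fin d))) : ℝ :=
  ∑ a : {x // x ∈ Q} → A, ∑ δ : {x // x ∈ U} → A, PE (ZA Q a * ZA U δ) ^ 2 / PE (ZA U δ)

/-- The average pseudocovariance of `Q` and `T` after conditioning on `U`. -/
def conditionalCov (PE : MvPolynomial (SoSVar k n d A) ℝ →ₗ[ℝ] ℝ)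
    (U Q T : Finset (Fin k × (Fin n × Fin d))) : ℝ :=
  ∑ γ : {x // x ∈ U} → A, if 0 < PE (ZA U γ) then
    PE (ZA U γ) * CovF (fun p => PE (p * ZA U γ) / PE (ZA U γ)) Q T else 0

namespace IsPseudoExpectation

variable {PE : MvPolynomial (SoSVar k n d A) ℝ →ₗ[ℝ] ℝ} {t : ℕ}

theorem sum_map_ZA (h : IsPseudoExpectation PE t) (T : Finset (Fin k × (Fin n × Fin d)))
    (hT : T.card ≤ t) : ∑ γ : {x // x ∈ T} → A, PE (ZA T γ) = 1 := by
  simpa [h.1] using h.sum_map_mul_ZA T 1 (by simpa using hT)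

theorem conditionalEnergy_le_one (h : IsPseudoExpectation PE t) (h4 : 0 < k → 4 ≤ t)
    (Q U : Finset (Fin k × (Fin n × Fin d))) (hQ : 2 * Q.card ≤ t) (hU : 2 * U.card ≤ t) :
    conditionalEnergy PE Q U ≤ 1 := by
  rw [← h.sum_map_ZA Q (by omega)]
  exact Finset.sum_le_sum fun a _ => h.sum_map_ZA_mul_sq_div_le h4 Q U hQ hU a

theorem conditionalEnergy_nonneg (h : IsPseudoExpectation PE t)
    (Q U : Finset (Fin k × (Fin n × Fin d))) (hU : 2 * U.card ≤ t) :
    0 ≤ conditionalEnergy PE Q U :=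
  Finset.sum_nonneg fun _ _ => Finset.sum_nonneg fun δ _ =>
    div_nonneg (sq_nonneg _) (h.map_ZA_nonneg U hU δ)

theorem map_ZA_mul_ZA_nonneg (h : IsPseudoExpectation PE t)
    (U T : Finset (Fin k × (Fin n × Fin d))) (hUT : 2 * (U.card + T.card) ≤ t)
    (γ : {x // x ∈ U} → A) (b : {x // x ∈ T} → A) : 0 ≤ PE (ZA U γ * ZA T b) := by
  have hg := card_assignmentGraph_le U γ
  have hb := card_assignmentGraph_le T b
  have hu := Finset.card_union_le (assignmentGraph U γ) (assignmentGraph T b)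
  rw [ZA_eq_sqfreeMonomial, ZA_eq_sqfreeMonomial, h.map_sqfreeMonomial_mul _ _ (by omega)]
  exact h.map_sqfreeMonomial_nonneg _ (by omega)

theorem map_mul_ZA_mul_ZA_eq_zero (h : IsPseudoExpectation PE t)
    (Q U T : Finset (Fin k × (Fin n × Fin d))) (hUT : 2 * (U.card + T.card) ≤ t)
    (hQ : 2 * Q.card ≤ t) (a : {x // x ∈ Q} → A)
    (γ : {x // x ∈ U} → A) (b : {x // x ∈ T} → A) (h0 : PE (ZA U γ * ZA T b) = 0) :
    PE (ZA Q a * (ZA U γ * ZA T b)) = 0 := by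
  have hg := card_assignmentGraph_le U γ
  have hb := card_assignmentGraph_le T b
  have hu := Finset.card_union_le (assignmentGraph U γ) (assignmentGraph T b)
  have hda := totalDegree_ZA_le Q a
  have hdu := totalDegree_ZA_le U γ
  have hdt := totalDegree_ZA_le T b
  have hm := totalDegree_mul (ZA U γ) (ZA T b)
  rw [mul_comm]
  refine h.map_mul_eq_zero (by omega) (by omega) ?_
  have hsq : (ZA U γ * ZA T b) ^ 2 =
      (ZA U γ * ZA T b) * (sqfreeMonomial (assignmentGraph U γ) *
        sqfreeMonomial (assignmentGraph T b)) := by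
    rw [sq, ← ZA_eq_sqfreeMonomial, ← ZA_eq_sqfreeMonomial]
  rw [hsq, h.map_mul_sqfreeMonomial_mul _ _ _ (by omega)]
  rw [ZA_eq_sqfreeMonomial, ZA_eq_sqfreeMonomial, h.map_sqfreeMonomial_mul _ _ (by omega)] at h0
  have hdU := totalDegree_sqfreeMonomial_le (assignmentGraph U γ ∪ assignmentGraph T b)
  rw [mul_comm]
  refine h.map_mul_eq_zero (by omega) (by omega) ?_
  rw [sq, h.map_sqfreeMonomial_mul _ _ (by omega), Finset.union_self, h0]

theorem conditionalCov_sq_le (h : IsPseudoExpectation PE t) (h4 : 0 < k → 4 ≤ t)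
    (Q U T : Finset (Fin k × (Fin n × Fin d))) (hUT : 2 * (U.card + T.card) ≤ t)
    (hQ : Q.card ≤ T.card) :
    conditionalCov PE U Q T ^ 2 ≤ Fintype.card ({x // x ∈ Q} → A) *
      (conditionalEnergy PE Q (U ∪ T) - conditionalEnergy PE Q U) := by
  have hP : ∀ γ : {x // x ∈ U} → A, 0 ≤ PE (ZA U γ) := h.map_ZA_nonneg U (by omega)
  have hunion : conditionalEnergy PE Q (U ∪ T) = ∑ a : {x // x ∈ Q} → A,
      ∑ γ : {x // x ∈ U} → A, ∑ b : {x // x ∈ T} → A,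
        PE (ZA Q a * (ZA U γ * ZA T b)) ^ 2 / PE (ZA U γ * ZA T b) := by
    refine Finset.sum_congr rfl fun a _ => ?_
    have hda := totalDegree_ZA_le Q a
    refine sum_union_assignments U T _ _ (fun δ => ?_) fun γ b x hxU hxT hne => ?_
    · have h1 := h.map_mul_ZA_union U T 1 (by simp; omega) δ
      rw [one_mul, one_mul] at h1
      rw [h.map_mul_ZA_union U T (ZA Q a) (by omega) δ, h1]
    · rw [h.map_ZA_mul_eq_zero h4 U T (by omega) a γ b hxU hxT hne]
      simp
  have hstep : ∀ γ : {x // x ∈ U} → A, 0 < PE (ZA U γ) →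
      PE (ZA U γ) * CovF (fun p => PE (p * ZA U γ) / PE (ZA U γ)) Q T ^ 2 ≤
        Fintype.card ({x // x ∈ Q} → A) * ∑ a : {x // x ∈ Q} → A,
          (∑ b : {x // x ∈ T} → A,
            PE (ZA Q a * (ZA U γ * ZA T b)) ^ 2 / PE (ZA U γ * ZA T b) -
              PE (ZA Q a * ZA U γ) ^ 2 / PE (ZA U γ)) := by
    intro γ hγ
    have hdg := totalDegree_ZA_le U γ
    have := mul_sq_sum_abs_cov_le (fun (a : {x // x ∈ Q} → A) (b : {x // x ∈ T} → A) =>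
      PE (ZA Q a * (ZA U γ * ZA T b))) (fun b => PE (ZA U γ * ZA T b))
      (fun a => PE (ZA Q a * ZA U γ)) hγ (h.map_ZA_mul_ZA_nonneg U T hUT γ)
      (h.sum_map_mul_ZA T _ (by omega))
      (fun a => by
        have hda := totalDegree_ZA_le Q a
        have hm := totalDegree_mul (ZA Q a) (ZA U γ)
        simp only [← mul_assoc]
        exact h.sum_map_mul_ZA T _ (by omega))
      (fun a b => h.map_mul_ZA_mul_ZA_eq_zero Q U T hUT (by omega) a γ b)
    have hcov : CovF (fun p => PE (p * ZA U γ) / PE (ZA U γ)) Q T =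
        ∑ a : {x // x ∈ Q} → A, ∑ b : {x // x ∈ T} → A,
          |PE (ZA Q a * (ZA U γ * ZA T b)) / PE (ZA U γ) -
            PE (ZA Q a * ZA U γ) / PE (ZA U γ) * (PE (ZA U γ * ZA T b) / PE (ZA U γ))| := by
      rw [CovF]
      refine Finset.sum_congr rfl fun a _ => Finset.sum_congr rfl fun b _ => ?_
      rw [mul_assoc, mul_comm (ZA T b)]
    rw [hcov]
    exact this
  have hcs := Finset.sum_sq_le_sum_mul_sum_of_sq_le_mul
    (Finset.univ : Finset ({x // x ∈ U} → A))
    (r := fun γ => if 0 < PE (ZA U γ) then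
      PE (ZA U γ) * CovF (fun p => PE (p * ZA U γ) / PE (ZA U γ)) Q T else 0)
    (f := fun γ => PE (ZA U γ))
    (g := fun γ => PE (ZA U γ) * CovF (fun p => PE (p * ZA U γ) / PE (ZA U γ)) Q T ^ 2)
    (fun γ _ => hP γ) (fun γ _ => mul_nonneg (hP γ) (sq_nonneg _))
    (fun γ _ => le_of_eq <| by
      rcases (hP γ).eq_or_lt with h0 | h0
      · simp [← h0]
      · simp only [h0, if_true]
        ring)
  rw [h.sum_map_ZA U (by omega), one_mul] at hcs
  refine hcs.trans ?_
  rw [hunion, conditionalEnergy, ← Finset.sum_sub_distrib]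
  simp only [← Finset.sum_sub_distrib]
  rw [Finset.sum_comm, Finset.mul_sum]
  refine Finset.sum_le_sum fun γ _ => ?_
  rcases (hP γ).eq_or_lt with h0 | h0
  · rw [← h0, zero_mul]
    refine mul_nonneg (Nat.cast_nonneg _) (Finset.sum_nonneg fun a _ => ?_)
    rw [div_zero, sub_zero]
    exact Finset.sum_nonneg fun b _ =>
      div_nonneg (sq_nonneg _) (h.map_ZA_mul_ZA_nonneg U T hUT γ b)
  · exact hstep γ h0

theorem abs_map_ZA_mul_sub_le (h : IsPseudoExpectation PE t)
    (Q T : Finset (Fin k × (Fin n × Fin d))) (hQ : 2 * Q.card ≤ t) (hT : 2 * T.card ≤ t)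
    (a : {x // x ∈ Q} → A) (b : {x // x ∈ T} → A) :
    |PE (ZA Q a * ZA T b) - PE (ZA Q a) * PE (ZA T b)| ≤ (PE (ZA Q a) + PE (ZA T b)) / 2 := by
  have hdeg : ∀ s : ℝ, 2 * (ZA Q a - C (PE (ZA Q a)) + C s * ZA T b).totalDegree ≤ t := by
    intro s
    have h1 := totalDegree_add (ZA Q a - C (PE (ZA Q a))) (C s * ZA T b)
    have h2 := totalDegree_sub_C_le (ZA Q a) (PE (ZA Q a))
    have h3 := totalDegree_mul (C s) (ZA T b)
    have h4 := totalDegree_ZA_le Q a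
    have h5 := totalDegree_ZA_le T b
    rw [totalDegree_C, zero_add] at h3
    rcases max_choice (ZA Q a - C (PE (ZA Q a))).totalDegree (C s * ZA T b).totalDegree
      with h6 | h6 <;> omega
  have hval : ∀ s : ℝ, s ^ 2 = 1 →
      PE ((ZA Q a - C (PE (ZA Q a)) + C s * ZA T b) ^ 2) =
        PE (ZA Q a) - PE (ZA Q a) ^ 2 + PE (ZA T b) +
          2 * s * (PE (ZA Q a * ZA T b) - PE (ZA Q a) * PE (ZA T b)) := by
    intro s hs
    set m := PE (ZA Q a) with hm
    have hexp : (ZA Q a - C m + C s * ZA T b) ^ 2 = ZA Q a * ZA Q a - (2 * m) • ZA Q a +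
        (m ^ 2) • 1 + (s ^ 2) • (ZA T b * ZA T b) + (2 * s) • (ZA Q a * ZA T b) -
          (2 * s * m) • ZA T b := by
      simp only [smul_eq_C_mul, map_mul, map_pow, map_ofNat]
      ring
    rw [hexp, map_sub, map_add, map_add, map_add, map_sub, h.map_ZA_sq Q hQ, map_smul, map_smul,
      map_smul, map_smul, map_smul, h.map_ZA_sq T hT, h.1, hs, ← hm]
    simp only [smul_eq_mul]
    ring
  have h1 := h.2.1 _ (hdeg 1)
  have h2 := h.2.1 _ (hdeg (-1))
  rw [hval 1 (by norm_num)] at h1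
  rw [hval (-1) (by norm_num)] at h2
  have := sq_nonneg (PE (ZA Q a))
  rw [abs_le]
  constructor <;> linarith

theorem conditionalCov_empty_le (h : IsPseudoExpectation PE t)
    (Q T : Finset (Fin k × (Fin n × Fin d))) (hQ : 2 * Q.card ≤ t) (hT : 2 * T.card ≤ t)
    (hQT : Q.card = T.card) :
    conditionalCov PE ∅ Q T ≤ (Fintype.card A : ℝ) ^ Q.card := by
  have hone : ∀ γ : {x // x ∈ (∅ : Finset (Fin k × (Fin n × Fin d)))} → A, ZA ∅ γ = 1 := by
    intro γ
    simp [ZA]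
  have hcov : conditionalCov PE ∅ Q T = CovF (fun p => PE p) Q T := by
    simp [conditionalCov, hone, h.1]
  rw [hcov, CovF]
  refine (Finset.sum_le_sum fun a _ => Finset.sum_le_sum fun b _ =>
    h.abs_map_ZA_mul_sub_le Q T hQ hT a b).trans_eq ?_
  simp only [← Finset.sum_div, Finset.sum_add_distrib, Finset.sum_const, Finset.card_univ, Fintype.card_fun,
    Fintype.card_coe, nsmul_eq_mul, ← Finset.mul_sum, h.sum_map_ZA Q (show Q.card ≤ t by omega),
    h.sum_map_ZA T (show T.card ≤ t by omega), hQT]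
  push_cast
  ring

end IsPseudoExpectation

theorem card_KNL (k d : ℕ) {n : ℕ} (ℓ : Fin n) : (KNL k d ℓ).card = k * d := by
  rw [KNL, Finset.card_product, Finset.card_image_of_injective _ (Prod.mk_right_injective ℓ)]
  simp

theorem card_KNR (k : ℕ) {n d : ℕ} (eR : Fin n × Fin d ≃ Fin n × Fin d) (r : Fin n) :
    (KNR k eR r).card = k * d := by
  rw [KNR, Finset.card_product, Finset.card_image_of_injective _
    (show Function.Injective fun j : Fin d => eR.symm (r, j) from
      eR.symm.injective.comp (Prod.mk_right_injective r))]
  simp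

/-- One greedy step: if the average covariance after conditioning on `U` exceeds `η`, then
conditioning additionally on some right neighbourhood increases the total energy. -/
theorem IsPseudoExpectation.exists_energy_increment
    {PE : MvPolynomial (SoSVar k n d A) ℝ →ₗ[ℝ] ℝ} {t : ℕ} (h : IsPseudoExpectation PE t)
    (h4 : 0 < k → 4 ≤ t) (hn : 0 < n) {η : ℝ} (hη : 0 < η) (eR : Fin n × Fin d ≃ Fin n × Fin d)
    (U : Finset (Fin k × (Fin n × Fin d))) (hU : 2 * (U.card + k * d) ≤ t)
    (hbad : η < (∑ ℓ : Fin n, ∑ r : Fin n,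
      conditionalCov PE U (KNL k d ℓ) (KNR k eR r)) / ((n : ℝ) * n)) :
    ∃ r : Fin n, n * η ^ 2 ≤ (Fintype.card A : ℝ) ^ (k * d) *
      (∑ ℓ : Fin n, conditionalEnergy PE (KNL k d ℓ) (U ∪ KNR k eR r) -
        ∑ ℓ : Fin n, conditionalEnergy PE (KNL k d ℓ) U) := by
  by_contra! hcon
  have hn' : (0 : ℝ) < n := Nat.cast_pos.2 hn
  rw [lt_div_iff₀ (mul_pos hn' hn'), ← Fintype.sum_prod_type'] at hbad
  have hcs := sq_sum_le_card_mul_sum_sq (s := (Finset.univ : Finset (Fin n × Fin n)))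
    (f := fun z => conditionalCov PE U (KNL k d z.1) (KNR k eR z.2))
  rw [Finset.card_univ, Fintype.card_prod, Fintype.card_fin] at hcs
  have hsum : ∑ z : Fin n × Fin n, conditionalCov PE U (KNL k d z.1) (KNR k eR z.2) ^ 2 ≤
      n * (n * η ^ 2) := by
    rw [Fintype.sum_prod_type_right]
    have hr : ∀ r : Fin n, ∑ ℓ : Fin n,
        conditionalCov PE U (KNL k d ℓ) (KNR k eR r) ^ 2 ≤ n * η ^ 2 := by
      intro r
      refine le_trans ?_ (hcon r).le
      rw [← Finset.sum_sub_distrib, Finset.mul_sum]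
      refine Finset.sum_le_sum fun ℓ _ => ?_
      have := h.conditionalCov_sq_le h4 (KNL k d ℓ) U (KNR k eR r)
        (by rw [card_KNR]; exact hU) (by rw [card_KNR, card_KNL])
      rwa [Fintype.card_fun, Fintype.card_coe, card_KNL, Nat.cast_pow] at this
    refine (Finset.sum_le_sum fun r _ => hr r).trans_eq ?_
    simp
  have hsq : (η * (n * n)) ^ 2 <
      (∑ z : Fin n × Fin n, conditionalCov PE U (KNL k d z.1) (KNR k eR z.2)) ^ 2 :=
    pow_lt_pow_left₀ hbad (by positivity) two_ne_zero
  have hle := mul_le_mul_of_nonneg_left hsum (by positivity : (0 : ℝ) ≤ ((n * n : ℕ) : ℝ))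
  have := hsq.trans_le (hcs.trans hle)
  push_cast at this
  nlinarith

/-- conditioning yields an `η`-good solution.  For a `k`-tuple of
pseudocodewords of high enough degree, there is a small set `S ⊆ E` such that the
solution conditioned on a random assignment to `Z_{[k]×S}` (drawn from its local
distribution) is `η`-good on average. -/
theorem sos_conditioning_eta_good
    {A : Type*} [Fintype A]
    (k n d : ℕ) (hn : 0 < n) (hd : 0 < d)
    (η : ℝ) (hη : 0 < η)
    (eR : Fin n × Fin d ≃ Fin n × Fin d)
    (Cin : Set (Fin d → A))
    (t : ℕ)
    (ht : (2 * (k : ℝ) * d) * (1 + (Fintype.card A : ℝ) ^ (3 * k * d) / η ^ 2) ≤ t)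
    (PE : MvPolynomial (SoSVar k n d A) ℝ →ₗ[ℝ] ℝ)
    (hPE : IsPseudocodeword Cin PE t) :
    ∃ S : Finset (Fin n × Fin d),
      (S.card : ℝ) ≤ d * (Fintype.card A : ℝ) ^ (3 * k * d) / η ^ 2 ∧
      (∑ ℓ : Fin n, ∑ r : Fin n,
          ∑ γ : {x // x ∈ (Finset.univ ×ˢ S : Finset (Fin k × (Fin n × Fin d)))} → A,
            if 0 < PE (ZA (Finset.univ ×ˢ S) γ) then
              PE (ZA (Finset.univ ×ˢ S) γ) *
                CovF
                  (fun p => PE (p * ZA (Finset.univ ×ˢ S) γ) / PE (ZA (Finset.univ ×ˢ S) γ))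
                  (KNL k d ℓ) (KNR k eR r)
            else 0)
          / ((n : ℝ) * n) ≤ η := by

  have h := hPE.1
  have hn' : (0 : ℝ) < n := Nat.cast_pos.2 hn
  set N : ℝ := (Fintype.card A : ℝ) ^ (k * d) with hN
  have hN3 : (Fintype.card A : ℝ) ^ (3 * k * d) = N ^ 3 := by
    rw [hN, ← pow_mul]
    ring_nf
  have hN0 : 0 ≤ N := by positivity
  have hNcases : N = 0 ∨ 1 ≤ N := by
    rw [hN, ← Nat.cast_pow]
    rcases Nat.eq_zero_or_pos (Fintype.card A ^ (k * d)) with h0 | h0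
    · exact Or.inl (by rw [h0, Nat.cast_zero])
    · exact Or.inr (by exact_mod_cast h0)
  rw [hN3] at ht ⊢
  set M : ℝ := N ^ 3 / η ^ 2 with hM
  have hM0 : 0 ≤ M := by positivity
  have hMd : d * N ^ 3 / η ^ 2 = d * M := mul_div_assoc _ _ _
  rw [hMd]
  change ∃ S : Finset (Fin n × Fin d), (S.card : ℝ) ≤ d * M ∧
    (∑ ℓ : Fin n, ∑ r : Fin n,
      conditionalCov PE (Finset.univ ×ˢ S) (KNL k d ℓ) (KNR k eR r)) / ((n : ℝ) * n) ≤ η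
  have hkd : 2 * (k * d) ≤ t := by
    have : (2 * (k : ℝ) * d) * (1 + 0) ≤ t :=
      le_trans (by gcongr) ht
    have h2 : ((2 * (k * d) : ℕ) : ℝ) ≤ t := by push_cast; linarith
    exact_mod_cast h2
  rcases le_or_gt N η with hNη | hNη
  · refine ⟨∅, by simp; positivity, ?_⟩
    rw [div_le_iff₀ (mul_pos hn' hn'), Finset.product_empty]
    calc ∑ ℓ : Fin n, ∑ r : Fin n, conditionalCov PE ∅ (KNL k d ℓ) (KNR k eR r)
        ≤ ∑ ℓ : Fin n, ∑ r : Fin n, η := by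
          refine Finset.sum_le_sum fun ℓ _ => Finset.sum_le_sum fun r _ => ?_
          refine le_trans ?_ hNη
          have := h.conditionalCov_empty_le (KNL k d ℓ) (KNR k eR r)
            (by rw [card_KNL]; exact hkd) (by rw [card_KNR]; exact hkd)
            (by rw [card_KNL, card_KNR])
          rwa [card_KNL] at this
      _ = η * (n * n) := by simp; ring
  · have hN1 : 1 ≤ N := hNcases.resolve_left fun h0 => by linarith
    have hM1 : 1 ≤ M := by
      rw [hM, one_le_div (by positivity)]
      nlinarith [pow_le_pow_left₀ hη.le hNη.le 2, sq_nonneg N]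
    have h4 : 0 < k → 4 ≤ t := by
      intro hk
      have hkd1 : (1 : ℝ) ≤ (k : ℝ) * d := by exact_mod_cast Nat.mul_pos hk hd
      have : (4 : ℝ) ≤ t := by nlinarith
      exact_mod_cast this
    by_contra! hbad
    have hbudget : ∀ (m : ℕ) (S : Finset (Fin n × Fin d)), (m : ℝ) ≤ M + 1 → S.card ≤ d * m →
        2 * (Finset.univ ×ˢ S : Finset (Fin k × (Fin n × Fin d))).card ≤ t := by
      intro m S hm hS
      rw [Finset.card_product, Finset.card_univ, Fintype.card_fin]
      have h1 : ((2 * (k * (d * m)) : ℕ) : ℝ) ≤ t := by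
        refine le_trans ?_ ht
        push_cast
        calc (2 : ℝ) * (k * (d * m)) = 2 * k * d * m := by ring
          _ ≤ 2 * k * d * (1 + M) := by gcongr; linarith
      exact le_trans (by gcongr) (Nat.cast_le.1 h1)
    have hiter : ∀ m : ℕ, (m : ℝ) ≤ M + 1 → ∃ S : Finset (Fin n × Fin d), S.card ≤ d * m ∧
        m * (n * η ^ 2) ≤ N * ∑ ℓ : Fin n,
          conditionalEnergy PE (KNL k d ℓ) (Finset.univ ×ˢ S) := by
      intro m
      induction m with
      | zero =>
        intro _
        refine ⟨∅, by simp, ?_⟩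
        rw [Nat.cast_zero, zero_mul]
        exact mul_nonneg hN0 (Finset.sum_nonneg fun ℓ _ =>
          h.conditionalEnergy_nonneg _ _ (by simp))
      | succ m ih =>
        intro hm
        have hmM : (m : ℝ) ≤ M := by push_cast at hm; linarith
        obtain ⟨S, hS, hSe⟩ := ih (by linarith)
        have hSM : (S.card : ℝ) ≤ d * M := by
          refine (Nat.cast_le.2 hS).trans ?_
          rw [Nat.cast_mul]
          gcongr
        have hSU : 2 * ((Finset.univ ×ˢ S : Finset (Fin k × (Fin n × Fin d))).card + k * d) ≤
            t := by
          rw [Finset.card_product, Finset.card_univ, Fintype.card_fin]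
          have h1 : ((2 * (k * (d * m) + k * d) : ℕ) : ℝ) ≤ t := by
            refine le_trans ?_ ht
            push_cast
            calc (2 : ℝ) * (k * (d * m) + k * d) = 2 * k * d * (1 + m) := by ring
              _ ≤ 2 * k * d * (1 + M) := by gcongr
          exact le_trans (by gcongr) (Nat.cast_le.1 h1)
        obtain ⟨r, hr⟩ := h.exists_energy_increment h4 hn hη eR _ hSU (hbad S hSM)
        refine ⟨S ∪ Finset.univ.image fun j : Fin d => eR.symm (r, j), ?_, ?_⟩
        · have h1 := Finset.card_union_le S (Finset.univ.image fun j : Fin d => eR.symm (r, j))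
          have h2 : (Finset.univ.image fun j : Fin d => eR.symm (r, j)).card ≤ d :=
            Finset.card_image_le.trans (by simp)
          rw [mul_add, mul_one]
          omega
        · rw [Finset.product_union]
          rw [KNR, mul_sub] at hr
          push_cast
          linarith
    obtain ⟨S, hS, hSe⟩ := hiter (⌊M⌋₊ + 1) (by
      push_cast
      linarith [Nat.floor_le hM0])
    have hfloor := Nat.lt_floor_add_one M
    have hle : ∑ ℓ : Fin n, conditionalEnergy PE (KNL k d ℓ) (Finset.univ ×ˢ S) ≤ n := by
      refine (Finset.sum_le_sum fun ℓ _ => h.conditionalEnergy_le_one h4 _ _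
        (by rw [card_KNL]; exact hkd) (hbudget _ S ?_ hS)).trans_eq (by simp)
      push_cast
      linarith [Nat.floor_le hM0]
    push_cast at hSe
    have h1 : M * (n * η ^ 2) < N * n :=
      (mul_lt_mul_of_pos_right hfloor (by positivity)).trans_le
        (hSe.trans (mul_le_mul_of_nonneg_left hle hN0))
    have h2 : M * (n * η ^ 2) = N ^ 3 * n := by
      rw [hM]
      field_simp
    rw [h2] at h1
    have h3 : N ≤ N ^ 3 := le_self_pow₀ hN1 (by norm_num)
    exact absurd (mul_le_mul_of_nonneg_right h3 hn'.le) (not_le.2 h1)
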